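/- Suppose X is ≤^d-d-complete and d_F(r) ≤ r for all r ∈ [0,∞], where d_F(r) = sup over x ∈ X and finite F ⊆ {y : d(y,x) < r} of inf { d(y,x) : y ∈ X such that d(z,y) = 0 for all z ∈ F }. Then for every d-Cauchy net (x_λ) in X there is a sequence (y_n)_{n∈ℕ} in X that is Cauchy for d^∨(x,y) = max(d(x,y), d(y,x)) (for every ε > 0 there is N with d^∨(y_m,y_n) < ε for all m,n ≥ N) such that lim_λ d(x_λ,z) = lim_n d(y_n,z) for all z ∈ X, and lim_{λ,n} d(x_λ,y_n) = 0 (for every ε > 0 there are α and N with d(x_λ,y_n) < ε whenever α ≺ λ and n ≥ N). -/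

import Mathlib

open scoped ENNReal

universe u v

/-- liminf of a `[0,∞]`-valued net indexed by a set with relation `r`. -/
noncomputable def netLiminf {ι : Type v} (r : ι → ι → Prop) (f : ι → ℝ≥0∞) : ℝ≥0∞ :=
  ⨆ γ : ι, ⨅ l : ι, ⨅ _ : r γ l, f l

/-- limsup of a `[0,∞]`-valued net indexed by a set with relation `r`. -/
noncomputable def netLimsup {ι : Type v} (r : ι → ι → Prop) (f : ι → ℝ≥0∞) : ℝ≥0∞ :=
  ⨅ γ : ι, ⨆ l : ι, ⨆ _ : r γ l, f l

/-- `lim f = L` : both liminf and limsup equal `L`. -/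
def NetLimEq {ι : Type v} (r : ι → ι → Prop) (f : ι → ℝ≥0∞) (L : ℝ≥0∞) : Prop :=
  netLiminf r f = L ∧ netLimsup r f = L

/-- `d` satisfies the triangle inequality. -/
def IsDistance {X : Type u} (d : X → X → ℝ≥0∞) : Prop :=
  ∀ x y z, d x z ≤ d x y + d y z

/-- the index relation is transitive and directed. -/
def DirectedIndex {ι : Type v} (r : ι → ι → Prop) : Prop :=
  (∀ a b c : ι, r a b → r b c → r a c) ∧ (∀ a b : ι, ∃ c, r a c ∧ r b c)

/-- `d`-Cauchy net. -/
def IsCauchyNet {X : Type u} {ι : Type v} (d : X → X → ℝ≥0∞) (r : ι → ι → Prop)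
    (x : ι → X) : Prop :=
  ∀ ε : ℝ≥0∞, 0 < ε → ∃ α, ∀ γ δ, r α γ → r γ δ → d (x γ) (x δ) < ε

/-- `d`-pre-Cauchy net. -/
def IsPreCauchyNet {X : Type u} {ι : Type v} (d : X → X → ℝ≥0∞) (r : ι → ι → Prop)
    (x : ι → X) : Prop :=
  ∀ ε : ℝ≥0∞, 0 < ε → ∃ α, ∀ γ, r α γ → ∃ β, ∀ δ, r β δ → d (x γ) (x δ) < ε

/-- `d`-reflexive net. -/
def IsReflexiveNet {X : Type u} {ι : Type v} (d : X → X → ℝ≥0∞) (r : ι → ι → Prop)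
    (x : ι → X) : Prop :=
  ∀ ε : ℝ≥0∞, 0 < ε → ∃ α, ∀ γ, r α γ → ∀ β, ∃ δ, r β δ ∧ d (x γ) (x δ) < ε

/-- `x` is a `d`-supremum of `Y`. -/
def IsDSup {X : Type u} (d : X → X → ℝ≥0∞) (Y : Set X) (x : X) : Prop :=
  (∀ y ∈ Y, d y x = 0) ∧ ∀ z, d x z = ⨆ y ∈ Y, d y z

/-- `x` is a `≤ᵈ`-supremum of `Y`. -/
def IsLeDSup {X : Type u} (d : X → X → ℝ≥0∞) (Y : Set X) (x : X) : Prop :=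
  (∀ y ∈ Y, d y x = 0) ∧ ∀ z, (∀ y ∈ Y, d y z = 0) → d x z = 0

/-- `Y` is `d`-directed. -/
def DDirected {X : Type u} (d : X → X → ℝ≥0∞) (Y : Set X) : Prop :=
  ∀ F : Finset X, ↑F ⊆ Y → ∀ ε : ℝ≥0∞, 0 < ε → ∃ y ∈ Y, ∀ z ∈ F, d z y < ε

/-- `Y` is `≤ᵈ`-directed (directed sets are nonempty). -/
def LeDDirected {X : Type u} (d : X → X → ℝ≥0∞) (Y : Set X) : Prop :=
  Y.Nonempty ∧ ∀ y₁ ∈ Y, ∀ y₂ ∈ Y, ∃ y ∈ Y, d y₁ y = 0 ∧ d y₂ y = 0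

/-- `X` is `f`-complete: every `f`-Cauchy net has an `X°°`-limit w.r.t. `f`. -/
def IsYonedaComplete {X : Type u} (f : X → X → ℝ≥0∞) : Prop :=
  ∀ (ι : Type u) (r : ι → ι → Prop) (x : ι → X), Nonempty ι → DirectedIndex r →
    IsCauchyNet f r x →
    ∃ z : X, (∀ c, f z c ≤ netLiminf r fun l => f (x l) c) ∧
             (∀ c, f c z ≤ netLiminf r fun l => f c (x l))

/-- `d^•(s) = sup_x inf { d(x,y) : y ≤ᵈ x^•_s }`. -/
noncomputable def dBulletUpper {X : Type u} (d : X → X → ℝ≥0∞) (s : ℝ≥0∞) : ℝ≥0∞ :=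
  ⨆ x : X, ⨅ y : X, ⨅ _ : ∀ z, d x z < s → d y z = 0, d x y

/-- `d_•(s) = sup_x inf { d(y,x) : x^s_• ≤ᵈ y }`. -/
noncomputable def dBulletLower {X : Type u} (d : X → X → ℝ≥0∞) (s : ℝ≥0∞) : ℝ≥0∞ :=
  ⨆ x : X, ⨅ y : X, ⨅ _ : ∀ z, d z x < s → d z y = 0, d y x

/-- `d_F(s)`. -/
noncomputable def dFin {X : Type u} (d : X → X → ℝ≥0∞) (s : ℝ≥0∞) : ℝ≥0∞ :=
  ⨆ x : X, ⨆ F : Finset X, ⨆ _ : ∀ z ∈ F, d z x < s,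
    ⨅ y : X, ⨅ _ : ∀ z ∈ F, d z y = 0, d y x

/-- `d_Φ(s)`. -/
noncomputable def dPhi {X : Type u} (d : X → X → ℝ≥0∞) (s : ℝ≥0∞) : ℝ≥0∞ :=
  ⨆ x : X, ⨆ F : Finset X, ⨆ _ : ∀ z ∈ F, d z x < s, ⨆ ε : ℝ≥0∞, ⨆ _ : 0 < ε,
    ⨅ y : X, ⨅ _ : ∀ z ∈ F, d z y < ε, d y x

/-- `e∘Φᵈ(x,y) = sup_{ε>0} inf { e(x,z) : d(z,y) < ε }`. -/
noncomputable def ePhiD {X : Type u} (e d : X → X → ℝ≥0∞) (x y : X) : ℝ≥0∞ :=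
  ⨆ ε : ℝ≥0∞, ⨆ _ : 0 < ε, ⨅ z : X, ⨅ _ : d z y < ε, e x z

/-- `f ⪅ g` : uniform subequivalence. -/
def SubEquiv {X : Type u} (f g : X → X → ℝ≥0∞) : Prop :=
  ∀ ε : ℝ≥0∞, 0 < ε → ∃ δ : ℝ≥0∞, 0 < δ ∧ ∀ x y, g x y ≤ δ → f x y ≤ ε

theorem netLiminf_le_netLimsup {ι : Type v} {r : ι → ι → Prop} (hr : DirectedIndex r)
    (f : ι → ℝ≥0∞) : netLiminf r f ≤ netLimsup r f := by
  refine iSup_le fun γ => le_iInf fun γ' => ?_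
  obtain ⟨c, hc, hc'⟩ := hr.2 γ γ'
  exact (iInf₂_le c hc).trans (le_iSup₂ (f := fun l (_ : r γ' l) => f l) c hc')

theorem le_netLiminf {ι : Type v} {r : ι → ι → Prop} {f : ι → ℝ≥0∞} {a : ℝ≥0∞} (γ : ι)
    (h : ∀ l, r γ l → a ≤ f l) : a ≤ netLiminf r f :=
  (le_iInf₂ h).trans (le_iSup (fun γ => ⨅ l : ι, ⨅ _ : r γ l, f l) γ)

theorem netLimsup_le {ι : Type v} {r : ι → ι → Prop} {f : ι → ℝ≥0∞} {a : ℝ≥0∞} (γ : ι)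
    (h : ∀ l, r γ l → f l ≤ a) : netLimsup r f ≤ a :=
  (iInf_le (fun γ => ⨆ l : ι, ⨆ _ : r γ l, f l) γ).trans (iSup₂_le h)

theorem netLimEq_of_le {ι : Type v} {r : ι → ι → Prop} (hr : DirectedIndex r)
    {f : ι → ℝ≥0∞} {L : ℝ≥0∞} (h₁ : L ≤ netLiminf r f) (h₂ : netLimsup r f ≤ L) :
    NetLimEq r f L :=
  ⟨((netLiminf_le_netLimsup hr f).trans h₂).antisymm h₁,
    h₂.antisymm (h₁.trans (netLiminf_le_netLimsup hr f))⟩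

theorem directedIndex_nat_lt : DirectedIndex (fun m n : ℕ => m < n) :=
  ⟨fun _ _ _ => lt_trans, fun a b => ⟨a + b + 1, by omega, by omega⟩⟩

theorem le_of_forall_inv_nat_le_add {a b : ℝ≥0∞}
    (h : ∀ n : ℕ, a ≤ ((n + 1 : ℕ) : ℝ≥0∞)⁻¹ + b) : a ≤ b := by
  refine le_of_forall_pos_le_add fun ε hε => ?_
  obtain ⟨n, hn⟩ := ENNReal.exists_inv_nat_lt hε.ne'
  refine (h n).trans ?_
  rw [add_comm]
  gcongr
  exact (ENNReal.inv_le_inv.2 (by exact_mod_cast n.le_succ)).trans hn.le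

theorem exists_dist_lt_of_dFin_le {X : Type u} {d : X → X → ℝ≥0∞} {s t : ℝ≥0∞}
    (hF : dFin d s ≤ s) (hst : s < t) {a : X} (F : Finset X) (hFa : ∀ z ∈ F, d z a < s) :
    ∃ y, (∀ z ∈ F, d z y = 0) ∧ d y a < t := by
  have h : (⨅ y : X, ⨅ _ : ∀ z ∈ F, d z y = 0, d y a) < t := by
    refine lt_of_le_of_lt (le_trans ?_ hF) hst
    exact le_iSup_of_le a (le_iSup_of_le F (le_iSup_of_le hFa le_rfl))
  obtain ⟨y, hy⟩ := iInf_lt_iff.1 h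
  obtain ⟨hy₁, hy₂⟩ := iInf_lt_iff.1 hy
  exact ⟨y, hy₁, hy₂⟩

/-- The points `y` with `limsup d(y, x_λ) < s`. -/
def netLowerBall {X : Type u} {ι : Type v} (d : X → X → ℝ≥0∞) (r : ι → ι → Prop)
    (x : ι → X) (s : ℝ≥0∞) : Set X :=
  {y | ∃ t < s, ∃ α, ∀ l, r α l → d y (x l) < t}

theorem IsCauchyNet.eventually_mem_netLowerBall {X : Type u} {ι : Type v}
    {d : X → X → ℝ≥0∞} {r : ι → ι → Prop} {x : ι → X} (hx : IsCauchyNet d r x)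
    {s : ℝ≥0∞} (hs : 0 < s) : ∃ α, ∀ l, r α l → x l ∈ netLowerBall d r x s := by
  obtain ⟨t, ht₀, hts⟩ := exists_between hs
  obtain ⟨α, hα⟩ := hx t ht₀
  exact ⟨α, fun l hl => ⟨t, hts, l, fun m hm => hα l m hl hm⟩⟩

theorem IsCauchyNet.leDDirected_netLowerBall {X : Type u} {ι : Type v}
    {d : X → X → ℝ≥0∞} (hd : IsDistance d) (hF : ∀ s : ℝ≥0∞, dFin d s ≤ s)
    {r : ι → ι → Prop} (hr : DirectedIndex r) {x : ι → X} (hx : IsCauchyNet d r x)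
    {s : ℝ≥0∞} (hs : 0 < s) : LeDDirected d (netLowerBall d r x s) := by
  classical
  constructor
  · obtain ⟨α, hα⟩ := hx.eventually_mem_netLowerBall hs
    obtain ⟨l, hl, -⟩ := hr.2 α α
    exact ⟨x l, hα l hl⟩
  · rintro y₁ ⟨t₁, ht₁, α₁, h₁⟩ y₂ ⟨t₂, ht₂, α₂, h₂⟩
    obtain ⟨u, hu, hus⟩ := exists_between (max_lt ht₁ ht₂)
    obtain ⟨v, huv, hvs⟩ := exists_between hus
    obtain ⟨α, hα⟩ := hx (v - u) (tsub_pos_of_lt huv)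
    obtain ⟨β, hβ₁, hβ₂⟩ := hr.2 α₁ α₂
    obtain ⟨δ, hδ, hδα⟩ := hr.2 β α
    obtain ⟨y, hy, hyδ⟩ := exists_dist_lt_of_dFin_le (hF (max t₁ t₂)) hu (a := x δ) {y₁, y₂}
      (by
        simp only [Finset.mem_insert, Finset.mem_singleton, forall_eq_or_imp, forall_eq]
        exact ⟨(h₁ δ (hr.1 _ _ _ hβ₁ hδ)).trans_le (le_max_left _ _),
          (h₂ δ (hr.1 _ _ _ hβ₂ hδ)).trans_le (le_max_right _ _)⟩)
    refine ⟨y, ⟨v, hvs, δ, fun l hl => ?_⟩, hy y₁ (by simp), hy y₂ (by simp)⟩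
    calc d y (x l) ≤ d y (x δ) + d (x δ) (x l) := hd _ _ _
      _ < u + (v - u) := ENNReal.add_lt_add hyδ (hα δ l hδα hl)
      _ = v := add_tsub_cancel_of_le huv.le

/-- A `d`-supremum of `netLowerBall d r x s` is at distance at most `s` above the limit of
the net. -/
theorem IsDSup.le_add_netLiminf {X : Type u} {ι : Type v} {d : X → X → ℝ≥0∞}
    (hd : IsDistance d) {r : ι → ι → Prop} {x : ι → X} {s : ℝ≥0∞} {w : X}
    (hw : IsDSup d (netLowerBall d r x s) w) (z : X) :
    d w z ≤ s + netLiminf r fun l => d (x l) z := by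
  rw [hw.2 z]
  refine iSup₂_le ?_
  rintro y ⟨t, hts, α, hα⟩
  rw [← tsub_le_iff_left]
  refine le_netLiminf α fun l hl => ?_
  rw [tsub_le_iff_left]
  exact (hd y (x l) z).trans (by gcongr; exact ((hα l hl).trans hts).le)

theorem IsDSup.netLimsup_le {X : Type u} {ι : Type v} {d : X → X → ℝ≥0∞}
    (hd : IsDistance d) {r : ι → ι → Prop} {x : ι → X} (hx : IsCauchyNet d r x)
    {s : ℝ≥0∞} (hs : 0 < s) {w : X}
    (hw : IsDSup d (netLowerBall d r x s) w) (z : X) :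
    netLimsup r (fun l => d (x l) z) ≤ d w z := by
  obtain ⟨α, hα⟩ := hx.eventually_mem_netLowerBall hs
  refine _root_.netLimsup_le α fun l hl => (hd _ w z).trans ?_
  rw [hw.1 _ (hα l hl), zero_add]

/-- If `X` is `≤ᵈ`-d-complete and `d_F ≤ I` then every d-Cauchy net admits a
`d^∨`-Cauchy sequence `(y_n)` with `(x_λ)d = (y_n)d` and `lim_{λ,n} d(x_λ,y_n) = 0`. -/
theorem cauchy_to_symmetric_cauchy_seq {X : Type u} {ι : Type v}
    (d : X → X → ℝ≥0∞) (hd : IsDistance d)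
    (hcomp : ∀ Y : Set X, LeDDirected d Y → ∃ x : X, IsDSup d Y x)
    (hF : ∀ s : ℝ≥0∞, dFin d s ≤ s)
    (r : ι → ι → Prop) (hne : Nonempty ι) (hr : DirectedIndex r)
    (x : ι → X) (hx : IsCauchyNet d r x) :
    ∃ y : ℕ → X,
      (∀ ε : ℝ≥0∞, 0 < ε → ∃ N : ℕ, ∀ m n : ℕ, N ≤ m → N ≤ n →
        max (d (y m) (y n)) (d (y n) (y m)) < ε) ∧
      (∀ z : X, ∃ L : ℝ≥0∞, NetLimEq r (fun l => d (x l) z) L ∧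
        NetLimEq (fun m n : ℕ => m < n) (fun n => d (y n) z) L) ∧
      (∀ ε : ℝ≥0∞, 0 < ε → ∃ (α : ι) (N : ℕ), ∀ (l : ι) (n : ℕ),
        r α l → N ≤ n → d (x l) (y n) < ε) := by
  have hs : ∀ n : ℕ, 0 < ((n + 1 : ℕ) : ℝ≥0∞)⁻¹ := fun n =>
    ENNReal.inv_pos.2 (ENNReal.natCast_ne_top _)
  have hanti : ∀ m n : ℕ, m ≤ n → ((n + 1 : ℕ) : ℝ≥0∞)⁻¹ ≤ ((m + 1 : ℕ) : ℝ≥0∞)⁻¹ :=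
    fun m n h => ENNReal.inv_le_inv.2 (by exact_mod_cast Nat.succ_le_succ h)
  choose y hy using fun n : ℕ => hcomp _ (hx.leDDirected_netLowerBall hd hF hr (hs n))
  have hzero : ∀ n, netLiminf r (fun l => d (x l) (y n)) = 0 := fun n => by
    obtain ⟨α, hα⟩ := hx.eventually_mem_netLowerBall (hs n)
    refine le_antisymm ((netLiminf_le_netLimsup hr _).trans ?_) zero_le
    exact netLimsup_le α fun l hl => ((hy n).1 _ (hα l hl)).le
  have hdist : ∀ m n, d (y m) (y n) ≤ ((m + 1 : ℕ) : ℝ≥0∞)⁻¹ := fun m n => by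
    simpa only [hzero, add_zero] using (hy m).le_add_netLiminf hd (y n)
  refine ⟨y, fun ε hε => ?_, fun z => ?_, fun ε hε => ?_⟩
  · obtain ⟨N, hN⟩ := ENNReal.exists_inv_nat_lt hε.ne'
    have hlt : ((N + 1 : ℕ) : ℝ≥0∞)⁻¹ < ε :=
      (ENNReal.inv_le_inv.2 (by exact_mod_cast N.le_succ)).trans_lt hN
    exact ⟨N, fun m n hm hn => max_lt (((hdist m n).trans (hanti N m hm)).trans_lt hlt)
      (((hdist n m).trans (hanti N n hn)).trans_lt hlt)⟩
  · have hlow := fun n => (hy n).netLimsup_le hd hx (hs n) z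
    have hupp := fun n => (hy n).le_add_netLiminf hd z
    refine ⟨netLiminf r fun l => d (x l) z, netLimEq_of_le hr le_rfl ?_,
      netLimEq_of_le directedIndex_nat_lt ?_ ?_⟩
    · exact le_of_forall_inv_nat_le_add fun n => (hlow n).trans (hupp n)
    · exact le_netLiminf 0 fun n _ => (netLiminf_le_netLimsup hr _).trans (hlow n)
    · exact le_of_forall_inv_nat_le_add fun n => netLimsup_le n fun m hm =>
        (hupp m).trans (by gcongr)
  · obtain ⟨α, hα⟩ := hx ε hε
    refine ⟨α, 0, fun l n hl _ => ?_⟩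
    obtain ⟨β, hβ⟩ := hx.eventually_mem_netLowerBall (hs n)
    obtain ⟨δ, hδ, hβδ⟩ := hr.2 l β
    calc d (x l) (y n) ≤ d (x l) (x δ) + d (x δ) (y n) := hd _ _ _
      _ = d (x l) (x δ) := by rw [(hy n).1 _ (hβ δ hβδ), add_zero]
      _ < ε := hα l δ hl hδ
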